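/- If x ∈ S_n is a maximal singular point (MSP) for w ∈ S_n and t ∈ R(x,w), then l(xt) = l(x) + 1. -/

import Mathlib

open scoped Classical

namespace BSW

/-- The number of inversions (the length) of a permutation of `Fin n`. -/
def invLen {n : ℕ} (w : Equiv.Perm (Fin n)) : ℕ :=
  (Finset.univ.filter (fun p : Fin n × Fin n => p.1 < p.2 ∧ w p.2 < w p.1)).card

/-- The rank function `r_w(p,q) = #{i : 1 ≤ i ≤ p and w(i) ≥ q}`, where the
permutation of `Fin n` is regarded as a permutation of `{1,…,n}` (so position
`i : Fin n` corresponds to `i+1` and value `w i` to `(w i)+1`). -/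
def rank {n : ℕ} (w : Equiv.Perm (Fin n)) (p q : ℤ) : ℕ :=
  (Finset.univ.filter (fun i : Fin n =>
    ((i : ℕ) : ℤ) + 1 ≤ p ∧ q ≤ ((w i : ℕ) : ℤ) + 1)).card

/-- The difference function `d_{x,w}(p,q) = r_w(p,q) − r_x(p,q)`. -/
def dxw {n : ℕ} (x w : Equiv.Perm (Fin n)) (p q : ℤ) : ℤ :=
  (rank w p q : ℤ) - (rank x p q : ℤ)

/-- The Bruhat order: `x ≤ w` iff `d_{x,w}` is everywhere non-negative. -/
def bruhatLE {n : ℕ} (x w : Equiv.Perm (Fin n)) : Prop :=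
  ∀ p q : ℤ, 0 ≤ dxw x w p q

/-- The set of transpositions in `S_n`. -/
def transpositions (n : ℕ) : Set (Equiv.Perm (Fin n)) :=
  {t | ∃ a b : Fin n, a ≠ b ∧ t = Equiv.swap a b}

/-- `R(x,w) = {t ∈ T : l(xt) > l(x) and xt ≤ w}`. -/
def R {n : ℕ} (x w : Equiv.Perm (Fin n)) : Set (Equiv.Perm (Fin n)) :=
  {t | t ∈ transpositions n ∧ invLen x < invLen (x * t) ∧ bruhatLE (x * t) w}

/-- `x` is a maximal singular point (MSP) for `w`. -/
def MSP {n : ℕ} (x w : Equiv.Perm (Fin n)) : Prop :=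
  bruhatLE x w ∧ ((invLen w : ℤ) - (invLen x : ℤ) < ((R x w).ncard : ℤ)) ∧
    ∀ t ∈ R x w, ((R (x * t) w).ncard : ℤ) = (invLen w : ℤ) - (invLen (x * t) : ℤ)

/-- `Δ(x,w) = {i : t_{{i,j}} ∈ R(x,w) for some j}`. -/
def Delta {n : ℕ} (x w : Equiv.Perm (Fin n)) : Set (Fin n) :=
  {i | ∃ j : Fin n, Equiv.swap i j ∈ R x w}

/-- `Δ(x,w)` as a finset. -/
noncomputable def DeltaFinset {n : ℕ} (x w : Equiv.Perm (Fin n)) : Finset (Fin n) :=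
  (Set.toFinite (Delta x w)).toFinset

/-- `σ ∈ S_k` is the flattening of `x` along the increasing enumeration `d_1 < … < d_k`
of a set `D` of positions with `#D = k`: the unique permutation of `{1,…,k}` with
`σ(a) < σ(b)` iff `x(d_a) < x(d_b)`. -/
def IsFlatteningOn {n k : ℕ} (x : Equiv.Perm (Fin n)) (D : Finset (Fin n))
    (hD : D.card = k) (σ : Equiv.Perm (Fin k)) : Prop :=
  ∀ a b : Fin k, σ a < σ b ↔ x ((D.orderIsoOfFin hD a : Fin n)) < x ((D.orderIsoOfFin hD b : Fin n))

/-- Values (0-indexed) of the permutation `x_{k,m} = [k,…,1, k+m,…,k+1]`. -/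
def xkmVal (k m i : ℕ) : ℕ :=
  if i < k then k - 1 - i else 2 * k + m - 1 - i

/-- Values (0-indexed) of the permutation `w_{k,m} = [k+m, k,…,2, k+m−1,…,k+1, 1]`. -/
def wkmVal (k m i : ℕ) : ℕ :=
  if i = 0 then k + m - 1
  else if i < k then k - i
  else if i < k + m - 1 then 2 * k + m - 2 - i
  else 0

/-- Values (0-indexed) of the permutation `x_{k,l,m} = [k,…,1, k+l,…,k+1, k+l+m,…,k+l+1]`. -/
def xklmVal (k l m i : ℕ) : ℕ :=
  if i < k then k - 1 - i
  else if i < k + l then 2 * k + l - 1 - i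
  else 2 * (k + l) + m - 1 - i

/-- Values (0-indexed) of the permutation
`w_{k,l,m} = [k+l, k,…,2, k+l+m, k+l−1,…,k+2, 1, k+l+m−1,…,k+l+1, k+1]`. -/
def wklmVal (k l m i : ℕ) : ℕ :=
  if i = 0 then k + l - 1
  else if i < k then k - i
  else if i = k then k + l + m - 1
  else if i < k + l - 1 then 2 * k + l - 1 - i
  else if i = k + l - 1 then 0
  else if i < k + l + m - 1 then 2 * (k + l) + m - 2 - i
  else k


/-- `rankFin w p q = #{i ≤ p : w i ≥ q}` with `0`-indexed arguments. -/
noncomputable def rankFin {n : ℕ} (w : Equiv.Perm (Fin n)) (p q : Fin n) : ℤ :=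
  ∑ i, if i ≤ p ∧ q ≤ w i then 1 else 0

/-- The difference function `d_{x,w}` with `0`-indexed arguments. -/
noncomputable def rankDiff {n : ℕ} (x w : Equiv.Perm (Fin n)) (p q : Fin n) : ℤ :=
  rankFin w p q - rankFin x p q

lemma dxw_eq_rankDiff {n : ℕ} (x w : Equiv.Perm (Fin n)) (p q : Fin n) :
    dxw x w ((p : ℕ) + 1) ((q : ℕ) + 1) = rankDiff x w p q := by
  simp [dxw, rank, rankDiff, rankFin]

lemma bruhatLE_iff {n : ℕ} (x w : Equiv.Perm (Fin n)) :
    bruhatLE x w ↔ ∀ p q, 0 ≤ rankDiff x w p q := by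
  constructor
  · intro h p q
    rw [← dxw_eq_rankDiff]
    exact h _ _
  · intro h p q
    by_cases hp : p < 1
    · have h0 (u : Equiv.Perm (Fin n)) : rank u p q = 0 := by
        simp only [rank, Finset.card_eq_zero, Finset.filter_eq_empty_iff]
        intro i _ hi
        omega
      simp [dxw, h0]
    by_cases hq : (n : ℤ) < q
    · have h0 (u : Equiv.Perm (Fin n)) : rank u p q = 0 := by
        simp only [rank, Finset.card_eq_zero, Finset.filter_eq_empty_iff]
        intro i _ hi
        have := (u i).isLt
        omega
      simp [dxw, h0]
    rcases Nat.eq_zero_or_pos n with rfl | hn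
    · simp [dxw, rank]
    have hP : (min p n - 1).toNat < n := by omega
    have hQ : (max q 1 - 1).toNat < n := by omega
    have h1 (u : Equiv.Perm (Fin n)) :
        rank u p q = rank u ((min p n - 1).toNat + 1) ((max q 1 - 1).toNat + 1) := by
      unfold rank
      congr 1
      ext i
      have := i.isLt
      have := (u i).isLt
      simp only [Finset.mem_filter, Finset.mem_univ, true_and]
      omega
    have := h ⟨_, hP⟩ ⟨_, hQ⟩
    rw [← dxw_eq_rankDiff] at this
    simpa only [dxw, h1] using this

lemma sum_eq_add_add_sum {n : ℕ} {a b : Fin n} (hab : a ≠ b) (f : Fin n → ℤ) :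
    ∑ i, f i = f a + f b + ∑ i ∈ Finset.univ \ {a, b}, f i := by
  rw [← Finset.sum_pair hab, add_comm, Finset.sum_sdiff (Finset.subset_univ _)]

lemma sum_sum_eq_add {n : ℕ} {a b : Fin n} (hab : a ≠ b) (F : Fin n → Fin n → ℤ) :
    ∑ i, ∑ j, F i j = (F a a + F a b + F b a + F b b) +
      ∑ p ∈ Finset.univ \ {a, b}, (F p a + F a p + F p b + F b p) +
      ∑ i ∈ Finset.univ \ {a, b}, ∑ j ∈ Finset.univ \ {a, b}, F i j := by
  simp only [sum_eq_add_add_sum hab, Finset.sum_add_distrib]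
  ring

lemma rankDiff_mul_swap {n : ℕ} (z w : Equiv.Perm (Fin n)) {a b : Fin n} (hab : a < b)
    (hz : z a < z b) (p q : Fin n) :
    rankDiff (z * Equiv.swap a b) w p q =
      rankDiff z w p q - if a ≤ p ∧ p < b ∧ z a < q ∧ q ≤ z b then 1 else 0 := by
  unfold rankDiff rankFin
  rw [sum_eq_add_add_sum hab.ne
      (fun i => if i ≤ p ∧ q ≤ (z * Equiv.swap a b) i then (1 : ℤ) else 0),
    sum_eq_add_add_sum hab.ne (fun i => if i ≤ p ∧ q ≤ z i then (1 : ℤ) else 0)]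
  have hrest : ∑ i ∈ Finset.univ \ {a, b},
      (if i ≤ p ∧ q ≤ (z * Equiv.swap a b) i then (1 : ℤ) else 0) =
      ∑ i ∈ Finset.univ \ {a, b}, (if i ≤ p ∧ q ≤ z i then (1 : ℤ) else 0) := by
    refine Finset.sum_congr rfl fun i hi => ?_
    simp only [Finset.mem_sdiff, Finset.mem_univ, Finset.mem_insert, Finset.mem_singleton,
      true_and, not_or] at hi
    simp [Equiv.swap_apply_of_ne_of_ne hi.1 hi.2]
  rw [hrest]
  simp only [Equiv.Perm.mul_apply, Equiv.swap_apply_left, Equiv.swap_apply_right]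
  grind

lemma invLen_eq_sum {n : ℕ} (z : Equiv.Perm (Fin n)) :
    (invLen z : ℤ) = ∑ i, ∑ j, if i < j ∧ z j < z i then 1 else 0 := by
  rw [← Finset.sum_product' Finset.univ Finset.univ
    (fun i j => if i < j ∧ z j < z i then (1 : ℤ) else 0)]
  simp [invLen]

lemma mem_compl_pair {n : ℕ} {a b p : Fin n} :
    p ∈ (Finset.univ \ {a, b} : Finset (Fin n)) ↔ p ≠ a ∧ p ≠ b := by
  simp

lemma invLen_lt_mul_swap {n : ℕ} (z : Equiv.Perm (Fin n)) {a b : Fin n} (hab : a < b)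
    (hz : z a < z b) : invLen z < invLen (z * Equiv.swap a b) := by
  zify
  rw [invLen_eq_sum, invLen_eq_sum, sum_sum_eq_add hab.ne, sum_sum_eq_add hab.ne]
  refine add_lt_add_of_lt_of_le (add_lt_add_of_lt_of_le ?_ (Finset.sum_le_sum fun p hp => ?_))
    (Finset.sum_le_sum fun i hi => Finset.sum_le_sum fun j hj => ?_)
  · simp only [Equiv.Perm.mul_apply, Equiv.swap_apply_left, Equiv.swap_apply_right]
    grind
  · rw [mem_compl_pair] at hp
    simp only [Equiv.Perm.mul_apply, Equiv.swap_apply_left, Equiv.swap_apply_right,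
      Equiv.swap_apply_of_ne_of_ne hp.1 hp.2]
    grind
  · rw [mem_compl_pair] at hi hj
    simp only [Equiv.Perm.mul_apply, Equiv.swap_apply_of_ne_of_ne hi.1 hi.2,
      Equiv.swap_apply_of_ne_of_ne hj.1 hj.2, le_refl]

lemma invLen_mul_swap_of_forall {n : ℕ} (z : Equiv.Perm (Fin n)) {a b : Fin n} (hab : a < b)
    (hz : z a < z b) (hcov : ∀ c, a < c → c < b → z a < z c → ¬ z c < z b) :
    invLen (z * Equiv.swap a b) = invLen z + 1 := by
  zify
  rw [invLen_eq_sum, invLen_eq_sum, sum_sum_eq_add hab.ne, sum_sum_eq_add hab.ne]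
  have h1 : ∑ p ∈ Finset.univ \ {a, b},
      ((if p < a ∧ (z * Equiv.swap a b) a < (z * Equiv.swap a b) p then (1 : ℤ) else 0) +
        (if a < p ∧ (z * Equiv.swap a b) p < (z * Equiv.swap a b) a then 1 else 0) +
        (if p < b ∧ (z * Equiv.swap a b) b < (z * Equiv.swap a b) p then 1 else 0) +
        (if b < p ∧ (z * Equiv.swap a b) p < (z * Equiv.swap a b) b then 1 else 0)) =
      ∑ p ∈ Finset.univ \ {a, b},
      ((if p < a ∧ z a < z p then (1 : ℤ) else 0) + (if a < p ∧ z p < z a then 1 else 0) +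
        (if p < b ∧ z b < z p then 1 else 0) + (if b < p ∧ z p < z b then 1 else 0)) := by
    refine Finset.sum_congr rfl fun p hp => ?_
    rw [mem_compl_pair] at hp
    have := hcov p
    have := z.injective.ne hp.1
    have := z.injective.ne hp.2
    simp only [Equiv.Perm.mul_apply, Equiv.swap_apply_left, Equiv.swap_apply_right,
      Equiv.swap_apply_of_ne_of_ne hp.1 hp.2]
    grind
  have h2 : ∑ i ∈ Finset.univ \ {a, b}, ∑ j ∈ Finset.univ \ {a, b},
      (if i < j ∧ (z * Equiv.swap a b) j < (z * Equiv.swap a b) i then (1 : ℤ) else 0) =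
      ∑ i ∈ Finset.univ \ {a, b}, ∑ j ∈ Finset.univ \ {a, b},
        (if i < j ∧ z j < z i then (1 : ℤ) else 0) := by
    refine Finset.sum_congr rfl fun i hi => Finset.sum_congr rfl fun j hj => ?_
    rw [mem_compl_pair] at hi hj
    simp only [Equiv.Perm.mul_apply, Equiv.swap_apply_of_ne_of_ne hi.1 hi.2,
      Equiv.swap_apply_of_ne_of_ne hj.1 hj.2]
  rw [h1, h2]
  simp only [Equiv.Perm.mul_apply, Equiv.swap_apply_left, Equiv.swap_apply_right]
  grind

/-- `rankDiff z w` has a nonpositive value on the rectangle `[i,j) × (u,v]`. -/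
def HasZero {n : ℕ} (z w : Equiv.Perm (Fin n)) (i j u v : Fin n) : Prop :=
  ∃ p q, i ≤ p ∧ p < j ∧ u < q ∧ q ≤ v ∧ rankDiff z w p q ≤ 0

/-- A noninversion `(i, j)` of `z` such that `swap i j` raises `z` while staying below `w`. -/
def Admissible {n : ℕ} (z w : Equiv.Perm (Fin n)) (i j : Fin n) : Prop :=
  i < j ∧ z i < z j ∧ ¬ HasZero z w i j (z i) (z j)

/-- A noninversion `(i, j)` of `z` such that `swap i j` raises `z` to something not below `w`. -/
def Obstructed {n : ℕ} (z w : Equiv.Perm (Fin n)) (i j : Fin n) : Prop :=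
  i < j ∧ z i < z j ∧ HasZero z w i j (z i) (z j)

/-- The number of obstructed noninversions. -/
noncomputable def numObstructed {n : ℕ} (z w : Equiv.Perm (Fin n)) : ℤ :=
  ∑ i, ∑ j, if Obstructed z w i j then 1 else 0

lemma HasZero.mono {n : ℕ} {z w : Equiv.Perm (Fin n)} {i j u v i' j' u' v' : Fin n}
    (h : HasZero z w i j u v) (hi : i' ≤ i) (hj : j ≤ j') (hu : u' ≤ u) (hv : v ≤ v') :
    HasZero z w i' j' u' v' := by
  obtain ⟨p, q, h1, h2, h3, h4, h5⟩ := h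
  exact ⟨p, q, hi.trans h1, h2.trans_le hj, hu.trans_lt h3, h4.trans hv, h5⟩

lemma HasZero.split_left {n : ℕ} {z w : Equiv.Perm (Fin n)} {i k u v : Fin n}
    (h : HasZero z w i k u v) (j : Fin n) : HasZero z w i j u v ∨ HasZero z w j k u v := by
  obtain ⟨p, q, h1, h2, h3, h4, h5⟩ := h
  rcases lt_or_ge p j with hp | hp
  · exact Or.inl ⟨p, q, h1, hp, h3, h4, h5⟩
  · exact Or.inr ⟨p, q, hp, h2, h3, h4, h5⟩

lemma HasZero.split_right {n : ℕ} {z w : Equiv.Perm (Fin n)} {i j u v : Fin n}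
    (h : HasZero z w i j u v) (m : Fin n) : HasZero z w i j u m ∨ HasZero z w i j m v := by
  obtain ⟨p, q, h1, h2, h3, h4, h5⟩ := h
  rcases le_or_gt q m with hq | hq
  · exact Or.inl ⟨p, q, h1, h2, h3, hq, h5⟩
  · exact Or.inr ⟨p, q, h1, h2, hq, h4, h5⟩

lemma bruhatLE_mul_swap_iff {n : ℕ} {z w : Equiv.Perm (Fin n)} (hzw : bruhatLE z w)
    {a b : Fin n} (hab : a < b) (hz : z a < z b) :
    bruhatLE (z * Equiv.swap a b) w ↔ ¬ HasZero z w a b (z a) (z b) := by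
  rw [bruhatLE_iff] at hzw ⊢
  simp only [rankDiff_mul_swap z w hab hz]
  constructor
  · rintro h ⟨p, q, h1, h2, h3, h4, h5⟩
    have := h p q
    rw [if_pos ⟨h1, h2, h3, h4⟩] at this
    omega
  · intro h p q
    have := hzw p q
    split_ifs with hr
    · by_contra hc
      exact h ⟨p, q, hr.1, hr.2.1, hr.2.2.1, hr.2.2.2, by omega⟩
    · omega

lemma swap_mem_R_iff {n : ℕ} {z w : Equiv.Perm (Fin n)} (hzw : bruhatLE z w)
    {a b : Fin n} (hab : a < b) : Equiv.swap a b ∈ R z w ↔ Admissible z w a b := by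
  constructor
  · rintro ⟨-, hl, hle⟩
    have hz : z a < z b := by
      by_contra hc
      have hba : z b < z a := lt_of_le_of_ne (not_lt.1 hc) (z.injective.ne hab.ne').symm.symm
      have := invLen_lt_mul_swap (z * Equiv.swap a b) hab (by simpa using hba)
      rw [mul_assoc, Equiv.swap_mul_self, mul_one] at this
      omega
    exact ⟨hab, hz, (bruhatLE_mul_swap_iff hzw hab hz).1 hle⟩
  · rintro ⟨-, hz, hn⟩
    exact ⟨⟨a, b, hab.ne, rfl⟩, invLen_lt_mul_swap z hab hz,
      (bruhatLE_mul_swap_iff hzw hab hz).2 hn⟩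

lemma mem_R_iff {n : ℕ} {z w : Equiv.Perm (Fin n)} (hzw : bruhatLE z w)
    {t : Equiv.Perm (Fin n)} : t ∈ R z w ↔ ∃ a b, Admissible z w a b ∧ t = Equiv.swap a b := by
  constructor
  · intro ht
    obtain ⟨a, b, hab, rfl⟩ := ht.1
    rcases hab.lt_or_gt with h | h
    · exact ⟨a, b, (swap_mem_R_iff hzw h).1 ht, rfl⟩
    · rw [Equiv.swap_comm] at ht ⊢
      exact ⟨b, a, (swap_mem_R_iff hzw h).1 ht, rfl⟩
  · rintro ⟨a, b, hA, rfl⟩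
    exact (swap_mem_R_iff hzw hA.1).2 hA

lemma ncard_R {n : ℕ} {z w : Equiv.Perm (Fin n)} (hzw : bruhatLE z w) :
    ((R z w).ncard : ℤ) = ∑ i, ∑ j, if Admissible z w i j then 1 else 0 := by
  have himg : R z w = (fun p : Fin n × Fin n => Equiv.swap p.1 p.2) ''
      {p | Admissible z w p.1 p.2} := by
    ext t
    rw [mem_R_iff hzw]
    simp only [Set.mem_image, Set.mem_ofPred_eq, Prod.exists]
    exact ⟨fun ⟨a, b, h, e⟩ => ⟨a, b, h, e.symm⟩, fun ⟨a, b, h, e⟩ => ⟨a, b, h, e.symm⟩⟩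
  have hinj : Set.InjOn (fun p : Fin n × Fin n => Equiv.swap p.1 p.2)
      {p | Admissible z w p.1 p.2} := by
    rintro ⟨a, b⟩ hab ⟨c, d⟩ hcd h
    have hab' : a < b := hab.1
    have hcd' : c < d := hcd.1
    have h1 := congrArg (fun e : Equiv.Perm (Fin n) => e a) h
    have h2 := congrArg (fun e : Equiv.Perm (Fin n) => e b) h
    simp only [Equiv.swap_apply_left, Equiv.swap_apply_right, Equiv.swap_apply_def] at h1 h2
    grind
  rw [himg, hinj.ncard_image,
    ← Finset.sum_product' Finset.univ Finset.univ
      (fun i j => if Admissible z w i j then (1 : ℤ) else 0),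
    Set.ncard_eq_toFinset_card']
  simp

lemma ncard_R_add_numObstructed {n : ℕ} {z w : Equiv.Perm (Fin n)} (hzw : bruhatLE z w) :
    ((R z w).ncard : ℤ) + numObstructed z w + invLen z =
      ∑ i : Fin n, ∑ j : Fin n, if i < j then 1 else 0 := by
  rw [ncard_R hzw, numObstructed, invLen_eq_sum]
  simp only [← Finset.sum_add_distrib]
  refine Finset.sum_congr rfl fun i _ => Finset.sum_congr rfl fun j _ => ?_
  have : i < j → z i ≠ z j := fun h => z.injective.ne h.ne
  unfold Admissible Obstructed
  grind

/-- Applying `swap a b` to `z` creates an obstructed noninversion joining `p` to `a` or `b`. -/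
def IsLost {n : ℕ} (z w : Equiv.Perm (Fin n)) (a b p : Fin n) : Prop :=
  (p < a ∧ z p < z a ∧ ¬ HasZero z w p a (z p) (z a) ∧ HasZero z w p a (z p) (z b) ∧
    HasZero z w p b (z p) (z a)) ∨
  (b < p ∧ z b < z p ∧ ¬ HasZero z w b p (z b) (z p) ∧ HasZero z w a p (z b) (z p) ∧
    HasZero z w b p (z a) (z p))

lemma hasZero_mul_swap_iff {n : ℕ} {z w : Equiv.Perm (Fin n)} {a b : Fin n} (hab : a < b)
    (hz : z a < z b) {i j u v : Fin n} (h : j ≤ a ∨ b ≤ i ∨ v ≤ z a ∨ z b ≤ u) :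
    HasZero (z * Equiv.swap a b) w i j u v ↔ HasZero z w i j u v := by
  unfold HasZero
  refine exists_congr fun p => exists_congr fun q => ?_
  rw [rankDiff_mul_swap z w hab hz]
  grind

lemma HasZero.mul_swap {n : ℕ} {z w : Equiv.Perm (Fin n)} {a b : Fin n} (hab : a < b)
    (hz : z a < z b) {i j u v : Fin n} (h : HasZero z w i j u v) :
    HasZero (z * Equiv.swap a b) w i j u v := by
  obtain ⟨p, q, h1, h2, h3, h4, h5⟩ := h
  refine ⟨p, q, h1, h2, h3, h4, ?_⟩
  rw [rankDiff_mul_swap z w hab hz]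
  split_ifs <;> omega

/-- The number of obstructed noninversions of `z` joining `p` to `a` or `b`. -/
noncomputable def starCount {n : ℕ} (z w : Equiv.Perm (Fin n)) (a b p : Fin n) : ℤ :=
  (if Obstructed z w p a then 1 else 0) + (if Obstructed z w a p then 1 else 0) +
    (if Obstructed z w p b then 1 else 0) + (if Obstructed z w b p then 1 else 0)

lemma starCount_le_and_eq_iff {n : ℕ} {z w : Equiv.Perm (Fin n)} {a b p : Fin n}
    (hA : Admissible z w a b) (hpa : p ≠ a) (hpb : p ≠ b) :
    starCount z w a b p ≤ starCount (z * Equiv.swap a b) w a b p ∧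
      (starCount z w a b p = starCount (z * Equiv.swap a b) w a b p ↔ ¬ IsLost z w a b p) := by
  obtain ⟨hab, hz, hn⟩ := hA
  have hza := z.injective.ne hpa
  have hzb := z.injective.ne hpb
  have hn' {i j u v : Fin n} (hi : a ≤ i) (hj : j ≤ b) (hu : z a ≤ u) (hv : v ≤ z b) :
      ¬ HasZero z w i j u v := fun h => hn (h.mono hi hj hu hv)
  have e1 {u v : Fin n} : HasZero (z * Equiv.swap a b) w p a u v ↔ HasZero z w p a u v :=
    hasZero_mul_swap_iff hab hz (by simp)
  have e2 {u v : Fin n} : HasZero (z * Equiv.swap a b) w b p u v ↔ HasZero z w b p u v :=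
    hasZero_mul_swap_iff hab hz (by simp)
  have e3 {u : Fin n} : HasZero (z * Equiv.swap a b) w p b u (z a) ↔ HasZero z w p b u (z a) :=
    hasZero_mul_swap_iff hab hz (by simp)
  have e4 {v : Fin n} : HasZero (z * Equiv.swap a b) w a p (z b) v ↔ HasZero z w a p (z b) v :=
    hasZero_mul_swap_iff hab hz (by simp)
  unfold starCount Obstructed IsLost
  simp only [Equiv.Perm.mul_apply, Equiv.swap_apply_left, Equiv.swap_apply_right,
    Equiv.swap_apply_of_ne_of_ne hpa hpb, e1, e2, e3, e4]
  have hc : (p < a ∧ p < b) ∨ (a < p ∧ p < b) ∨ (a < p ∧ b < p) := by grind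
  have hr : (z p < z a ∧ z p < z b) ∨ (z a < z p ∧ z p < z b) ∨ (z a < z p ∧ z b < z p) := by grind
  rcases hc with ⟨h1, h2⟩ | ⟨h1, h2⟩ | ⟨h1, h2⟩ <;>
    rcases hr with ⟨h3, h4⟩ | ⟨h3, h4⟩ | ⟨h3, h4⟩ <;>
    simp only [h1, h2, h3, h4, not_lt_of_gt, true_and, false_and, if_false, zero_add, add_zero,
      false_or, or_false, not_false_eq_true, le_refl]
  · have m1 : HasZero z w p a (z p) (z a) → HasZero z w p a (z p) (z b) := fun h =>
      h.mono le_rfl le_rfl le_rfl hz.le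
    have m2 : HasZero z w p a (z p) (z a) → HasZero z w p b (z p) (z a) := fun h =>
      h.mono le_rfl hab.le le_rfl le_rfl
    have m3 : HasZero z w p a (z p) (z b) → HasZero z w p b (z p) (z b) := fun h =>
      h.mono le_rfl hab.le le_rfl le_rfl
    have m4 : HasZero z w p b (z p) (z a) → HasZero z w p b (z p) (z b) := fun h =>
      h.mono le_rfl le_rfl le_rfl hz.le
    have m5 : HasZero z w p b (z p) (z b) →
        HasZero z w p a (z p) (z b) ∨ HasZero z w p b (z p) (z a) := by
      intro h
      rcases h.split_left a with h | h
      · exact Or.inl h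
      rcases h.split_right (z a) with h | h
      · exact Or.inr (h.mono h1.le le_rfl le_rfl le_rfl)
      · exact absurd h hn
    grind
  · have m1 : HasZero z w p b (z p) (z b) ↔ HasZero z w p a (z p) (z b) :=
      ⟨fun h => (h.split_left a).resolve_right (hn' le_rfl le_rfl h3.le le_rfl),
        fun h => h.mono le_rfl hab.le le_rfl le_rfl⟩
    simp [m1]
  · have m1 : HasZero z w p b (z p) (z b) ↔ HasZero z w p b (z p) (z a) :=
      ⟨fun h => (h.split_right (z a)).resolve_right (hn' h1.le le_rfl le_rfl le_rfl),
        fun h => h.mono le_rfl le_rfl le_rfl hz.le⟩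
    simp [m1]
  · simp [hn' le_rfl h2.le le_rfl h4.le, hn' h1.le le_rfl h3.le le_rfl]
  · have m1 : HasZero z w a p (z a) (z p) ↔ HasZero z w a p (z b) (z p) :=
      ⟨fun h => (h.split_right (z b)).resolve_left (hn' le_rfl h2.le le_rfl le_rfl),
        fun h => h.mono le_rfl le_rfl hz.le le_rfl⟩
    simp [m1]
  · have m1 : HasZero z w a p (z a) (z p) ↔ HasZero z w b p (z a) (z p) :=
      ⟨fun h => (h.split_left b).resolve_left (hn' le_rfl le_rfl le_rfl h4.le),
        fun h => h.mono hab.le le_rfl le_rfl le_rfl⟩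
    simp [m1]
  · have m1 : HasZero z w b p (z b) (z p) → HasZero z w b p (z a) (z p) := fun h =>
      h.mono le_rfl le_rfl hz.le le_rfl
    have m2 : HasZero z w b p (z b) (z p) → HasZero z w a p (z b) (z p) := fun h =>
      h.mono hab.le le_rfl le_rfl le_rfl
    have m3 : HasZero z w b p (z a) (z p) → HasZero z w a p (z a) (z p) := fun h =>
      h.mono hab.le le_rfl le_rfl le_rfl
    have m4 : HasZero z w a p (z b) (z p) → HasZero z w a p (z a) (z p) := fun h =>
      h.mono le_rfl le_rfl hz.le le_rfl
    have m5 : HasZero z w a p (z a) (z p) →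
        HasZero z w a p (z b) (z p) ∨ HasZero z w b p (z a) (z p) := by
      intro h
      rcases h.split_left b with h | h
      · rcases h.split_right (z b) with h | h
        · exact absurd h hn
        · exact Or.inl (h.mono le_rfl h2.le le_rfl le_rfl)
      · exact Or.inr h
    grind

/-- The noninversion `(i, j)` is admissible for `z` but obstructed after applying `swap a b`. -/
def IsBlocked {n : ℕ} (z w : Equiv.Perm (Fin n)) (a b i j : Fin n) : Prop :=
  Admissible z w i j ∧ ∃ p q, (i ≤ p ∧ p < j ∧ z i < q ∧ q ≤ z j) ∧
    (a ≤ p ∧ p < b ∧ z a < q ∧ q ≤ z b) ∧ rankDiff z w p q ≤ 1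

lemma obstructed_le_and_eq_iff {n : ℕ} {z w : Equiv.Perm (Fin n)} {a b i j : Fin n}
    (hA : Admissible z w a b) (hi : i ≠ a ∧ i ≠ b) (hj : j ≠ a ∧ j ≠ b) :
    (if Obstructed z w i j then (1 : ℤ) else 0) ≤
        (if Obstructed (z * Equiv.swap a b) w i j then 1 else 0) ∧
      ((if Obstructed z w i j then (1 : ℤ) else 0) =
        (if Obstructed (z * Equiv.swap a b) w i j then 1 else 0) ↔ ¬ IsBlocked z w a b i j) := by
  obtain ⟨hab, hz, hn⟩ := hA
  have h1 : Obstructed z w i j → Obstructed (z * Equiv.swap a b) w i j := by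
    rintro ⟨h1, h2, h3⟩
    refine ⟨h1, ?_⟩
    simp only [Equiv.Perm.mul_apply, Equiv.swap_apply_of_ne_of_ne hi.1 hi.2,
      Equiv.swap_apply_of_ne_of_ne hj.1 hj.2]
    exact ⟨h2, h3.mul_swap hab hz⟩
  have h2 : IsBlocked z w a b i j ↔
      ¬ Obstructed z w i j ∧ Obstructed (z * Equiv.swap a b) w i j := by
    unfold IsBlocked Obstructed Admissible HasZero
    simp only [rankDiff_mul_swap z w hab hz]
    simp only [Equiv.Perm.mul_apply, Equiv.swap_apply_of_ne_of_ne hi.1 hi.2,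
      Equiv.swap_apply_of_ne_of_ne hj.1 hj.2]
    constructor
    · rintro ⟨⟨hij, hzij, hno⟩, p, q, hr, hr', hd⟩
      exact ⟨fun h => hno h.2.2, hij, hzij, p, q, hr.1, hr.2.1, hr.2.2.1, hr.2.2.2, by
        rw [if_pos hr']; omega⟩
    · rintro ⟨hno, hij, hzij, p, q, c1, c2, c3, c4, hd⟩
      have hno' : ¬ ∃ p q, i ≤ p ∧ p < j ∧ z i < q ∧ q ≤ z j ∧ rankDiff z w p q ≤ 0 :=
        fun h => hno ⟨hij, hzij, h⟩
      refine ⟨⟨hij, hzij, hno'⟩, p, q, ⟨c1, c2, c3, c4⟩, ?_⟩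
      split_ifs at hd with hr
      · exact ⟨hr, by omega⟩
      · exact absurd ⟨p, q, c1, c2, c3, c4, by omega⟩ hno'
  by_cases h3 : Obstructed z w i j <;> by_cases h4 : Obstructed (z * Equiv.swap a b) w i j <;>
    simp_all

lemma numObstructed_le_and_eq_iff {n : ℕ} {z w : Equiv.Perm (Fin n)} {a b : Fin n}
    (hA : Admissible z w a b) :
    numObstructed z w ≤ numObstructed (z * Equiv.swap a b) w ∧
      (numObstructed z w = numObstructed (z * Equiv.swap a b) w ↔
        (∀ p, p ≠ a ∧ p ≠ b → ¬ IsLost z w a b p) ∧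
        ∀ i j, i ≠ a ∧ i ≠ b → j ≠ a ∧ j ≠ b → ¬ IsBlocked z w a b i j) := by
  have hs : ∀ p ∈ (Finset.univ \ {a, b} : Finset (Fin n)),
      starCount z w a b p ≤ starCount (z * Equiv.swap a b) w a b p := fun p hp =>
    (starCount_le_and_eq_iff hA (mem_compl_pair.1 hp).1 (mem_compl_pair.1 hp).2).1
  have hs2 : ∀ i ∈ (Finset.univ \ {a, b} : Finset (Fin n)),
      ∀ j ∈ (Finset.univ \ {a, b} : Finset (Fin n)),
      (if Obstructed z w i j then (1 : ℤ) else 0) ≤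
        (if Obstructed (z * Equiv.swap a b) w i j then 1 else 0) := fun i hi j hj =>
    (obstructed_le_and_eq_iff hA (mem_compl_pair.1 hi) (mem_compl_pair.1 hj)).1
  have hs3 := fun i hi => Finset.sum_le_sum (hs2 i hi)
  have hsum1 := Finset.sum_le_sum hs
  have hsum2 := Finset.sum_le_sum hs3
  have heq1 := Finset.sum_eq_sum_iff_of_le hs
  have heq2 := Finset.sum_eq_sum_iff_of_le hs3
  have hE (u : Equiv.Perm (Fin n)) (hu : ¬ Obstructed u w a b) : numObstructed u w =
      ∑ p ∈ Finset.univ \ {a, b}, starCount u w a b p +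
      ∑ i ∈ Finset.univ \ {a, b}, ∑ j ∈ Finset.univ \ {a, b},
        if Obstructed u w i j then (1 : ℤ) else 0 := by
    have h1 : ¬ Obstructed u w a a := fun h => lt_irrefl _ h.1
    have h2 : ¬ Obstructed u w b b := fun h => lt_irrefl _ h.1
    have h3 : ¬ Obstructed u w b a := fun h => lt_asymm hA.1 h.1
    unfold numObstructed starCount
    rw [sum_sum_eq_add hA.1.ne]
    simp only [h1, h2, h3, hu, if_false]
    ring
  rw [hE z fun h => hA.2.2 h.2.2,
    hE (z * Equiv.swap a b) fun h => lt_asymm hA.2.1 (by simpa using h.2.1)]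
  refine ⟨add_le_add hsum1 hsum2, ?_⟩
  have hiff1 : (∀ p, p ≠ a ∧ p ≠ b → ¬ IsLost z w a b p) ↔
      ∀ p ∈ (Finset.univ \ {a, b} : Finset (Fin n)),
        starCount z w a b p = starCount (z * Equiv.swap a b) w a b p :=
    forall_congr' fun p => by
      rw [mem_compl_pair]
      exact forall_congr' fun hp => (starCount_le_and_eq_iff hA hp.1 hp.2).2.symm
  have hiff2 : (∀ i j, i ≠ a ∧ i ≠ b → j ≠ a ∧ j ≠ b → ¬ IsBlocked z w a b i j) ↔
      ∀ i ∈ (Finset.univ \ {a, b} : Finset (Fin n)),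
        ∑ j ∈ Finset.univ \ {a, b}, (if Obstructed z w i j then (1 : ℤ) else 0) =
        ∑ j ∈ Finset.univ \ {a, b},
          (if Obstructed (z * Equiv.swap a b) w i j then (1 : ℤ) else 0) := by
    refine forall_congr' fun i => ?_
    have (hi : i ≠ a ∧ i ≠ b) := Finset.sum_eq_sum_iff_of_le (hs2 i (mem_compl_pair.2 hi))
    rw [mem_compl_pair]
    constructor
    · intro h hi
      exact (this hi).2 fun j hj => (obstructed_le_and_eq_iff hA hi (mem_compl_pair.1 hj)).2.2
        (h j hi (mem_compl_pair.1 hj))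
    · intro h j hi hj
      exact (obstructed_le_and_eq_iff hA hi hj).2.1
        ((this hi).1 (h hi) j (mem_compl_pair.2 hj))
  rw [hiff1, hiff2, ← heq1, ← heq2]
  constructor
  · intro h
    constructor <;> linarith
  · rintro ⟨h1, h2⟩
    rw [h1, h2]

lemma dxw_add_two_eq {n : ℕ} (x w : Equiv.Perm (Fin n)) (p q : Fin n) :
    dxw x w ((p : ℕ) + 1) ((q : ℕ) + 2) =
      (∑ i, if i ≤ p ∧ q < w i then 1 else 0) - ∑ i, if i ≤ p ∧ q < x i then 1 else 0 := by
  have h (u : Equiv.Perm (Fin n)) (i : Fin n) :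
      ((q : ℕ) : ℤ) + 2 ≤ ((u i : ℕ) : ℤ) + 1 ↔ q < u i := by
    rw [Fin.lt_def]
    omega
  simp [dxw, rank, h]

lemma exists_admissible {n : ℕ} {z w : Equiv.Perm (Fin n)} (hzw : bruhatLE z w) (hne : z ≠ w) :
    ∃ a b, Admissible z w a b := by
  obtain ⟨a, ha, hmin⟩ := WellFounded.has_min (wellFounded_lt (α := Fin n)) {i | z i ≠ w i}
    (by
      by_contra h
      rw [Set.not_nonempty_iff_eq_empty, Set.eq_empty_iff_forall_notMem] at h
      exact hne (Equiv.ext fun i => not_not.1 (h i)))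
  have hlt : ∀ i < a, z i = w i := fun i hi => by
    by_contra h
    exact hmin i h hi
  have hle : z a ≤ w a := by
    by_contra hc
    have h := (bruhatLE_iff z w).1 hzw a (z a)
    have : rankDiff z w a (z a) < 0 := by
      unfold rankDiff rankFin
      rw [sub_neg]
      refine Finset.sum_lt_sum (fun i _ => ?_) ⟨a, Finset.mem_univ _, ?_⟩
      · have := hlt i
        grind
      · grind
    omega
  have hza : z a < w a := lt_of_le_of_ne hle ha
  obtain ⟨b, ⟨hab, hzb, hbw⟩, hbmin⟩ := WellFounded.has_min (wellFounded_lt (α := Fin n))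
    {i | a < i ∧ z a < z i ∧ z i ≤ w a} (by
      refine ⟨z.symm (w a), ?_, by simpa using hza, by simp⟩
      rcases lt_trichotomy (z.symm (w a)) a with h | h | h
      · have h' := hlt _ h
        rw [Equiv.apply_symm_apply] at h'
        exact absurd (w.injective h').symm h.ne
      · rw [Equiv.symm_apply_eq] at h
        exact absurd h.symm ha
      · exact h)
  refine ⟨a, b, hab, hzb, ?_⟩
  rintro ⟨p, q, hap, hpb, hq, hqb, hd⟩
  have h1 := hzw ((p : ℕ) + 1) ((w a : ℕ) + 2)
  rw [dxw_add_two_eq] at h1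
  have h2 : ∑ i, ((if i ≤ p ∧ q ≤ z i then (1 : ℤ) else 0) + (if i ≤ p ∧ w a < w i then 1 else 0))
      < ∑ i, ((if i ≤ p ∧ q ≤ w i then (1 : ℤ) else 0) + (if i ≤ p ∧ w a < z i then 1 else 0)) := by
    refine Finset.sum_lt_sum (fun i _ => ?_) ⟨a, Finset.mem_univ _, ?_⟩
    · have h3 := hlt i
      have h4 : a < i → i ≤ p → z a < z i → ¬ z i ≤ w a := fun h5 h6 h7 h8 =>
        hbmin i ⟨h5, h7, h8⟩ (h6.trans_lt hpb)
      rcases lt_trichotomy i a with h | rfl | h <;> grind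
    · grind
  simp only [Finset.sum_add_distrib] at h2
  unfold rankDiff rankFin at hd
  linarith

lemma invLen_le {n : ℕ} (z : Equiv.Perm (Fin n)) : invLen z ≤ n * n := by
  refine (Finset.card_filter_le _ _).trans ?_
  simp

lemma Admissible.bruhatLE_mul_swap {n : ℕ} {z w : Equiv.Perm (Fin n)} {a b : Fin n}
    (hA : Admissible z w a b) (hzw : bruhatLE z w) : bruhatLE (z * Equiv.swap a b) w :=
  (bruhatLE_mul_swap_iff hzw hA.1 hA.2.1).2 hA.2.2

lemma numObstructed_le_self {n : ℕ} {z w : Equiv.Perm (Fin n)} (hzw : bruhatLE z w) :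
    numObstructed z w ≤ numObstructed w w := by
  induction h : n * n - invLen z using Nat.strong_induction_on generalizing z with
  | _ k ih =>
    by_cases hne : z = w
    · rw [hne]
    obtain ⟨a, b, hA⟩ := exists_admissible hzw hne
    have h1 := invLen_lt_mul_swap z hA.1 hA.2.1
    have h2 := invLen_le (z * Equiv.swap a b)
    exact (numObstructed_le_and_eq_iff hA).1.trans
      (ih _ (by omega) (hA.bruhatLE_mul_swap hzw) rfl)

lemma ncard_R_self {n : ℕ} (w : Equiv.Perm (Fin n)) : (R w w).ncard = 0 := by
  have hw : bruhatLE w w := fun p q => by simp [dxw]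
  rw [Set.ncard_eq_zero (Set.toFinite _), Set.eq_empty_iff_forall_notMem]
  intro t ht
  obtain ⟨a, b, ⟨hab, hz, hn⟩, -⟩ := (mem_R_iff hw).1 ht
  exact hn ⟨a, w b, le_rfl, hab, hz, le_rfl, by simp [rankDiff]⟩

/-- No admissible noninversion of `y` creates new obstructions. -/
def IsClean {n : ℕ} (y w : Equiv.Perm (Fin n)) : Prop :=
  ∀ a b, Admissible y w a b → (∀ p, p ≠ a ∧ p ≠ b → ¬ IsLost y w a b p) ∧
    ∀ i j, i ≠ a ∧ i ≠ b → j ≠ a ∧ j ≠ b → ¬ IsBlocked y w a b i j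

lemma isClean_of_numObstructed_eq {n : ℕ} {y w : Equiv.Perm (Fin n)} (hyw : bruhatLE y w)
    (h : numObstructed y w = numObstructed w w) : IsClean y w := by
  intro a b hA
  have h1 := numObstructed_le_and_eq_iff hA
  have h2 := numObstructed_le_self (hA.bruhatLE_mul_swap hyw)
  exact h1.2.1 (le_antisymm h1.1 (h ▸ h2))

section Interior

variable {n : ℕ} {x w : Equiv.Perm (Fin n)} {a b c : Fin n}

lemma admissible_left_mul_swap_left (hA : Admissible x w a b) (hac : a < c) (hcb : c < b)
    (hxac : x a < x c) (hxcb : x c < x b) : Admissible (x * Equiv.swap a c) w a b := by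
  have hb : (x * Equiv.swap a c) b = x b := by
    simp [Equiv.swap_apply_of_ne_of_ne (hac.trans hcb).ne' hcb.ne']
  refine ⟨hA.1, by simpa [hb] using hxcb, ?_⟩
  rw [hb, Equiv.Perm.mul_apply, Equiv.swap_apply_left,
    hasZero_mul_swap_iff hac hxac (by simp)]
  exact fun h => hA.2.2 (h.mono le_rfl le_rfl hxac.le le_rfl)

lemma admissible_right_mul_swap_left (hA : Admissible x w a b) (hac : a < c) (hcb : c < b)
    (hxac : x a < x c) : Admissible (x * Equiv.swap a c) w c b := by
  have hb : (x * Equiv.swap a c) b = x b := by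
    simp [Equiv.swap_apply_of_ne_of_ne (hac.trans hcb).ne' hcb.ne']
  refine ⟨hcb, by simpa [hb] using hA.2.1, ?_⟩
  rw [hb, Equiv.Perm.mul_apply, Equiv.swap_apply_right,
    hasZero_mul_swap_iff hac hxac (by simp)]
  exact fun h => hA.2.2 (h.mono hac.le le_rfl le_rfl le_rfl)

lemma admissible_left_mul_swap_right (hA : Admissible x w a b) (hac : a < c) (hcb : c < b)
    (hxcb : x c < x b) : Admissible (x * Equiv.swap c b) w a c := by
  have ha : (x * Equiv.swap c b) a = x a := by
    simp [Equiv.swap_apply_of_ne_of_ne hac.ne (hac.trans hcb).ne]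
  refine ⟨hac, by simpa [ha] using hA.2.1, ?_⟩
  rw [ha, Equiv.Perm.mul_apply, Equiv.swap_apply_left,
    hasZero_mul_swap_iff hcb hxcb (by simp)]
  exact fun h => hA.2.2 (h.mono le_rfl hcb.le le_rfl le_rfl)

lemma admissible_right_mul_swap_right (hA : Admissible x w a b) (hac : a < c) (hcb : c < b)
    (hxac : x a < x c) (hxcb : x c < x b) : Admissible (x * Equiv.swap c b) w a b := by
  have ha : (x * Equiv.swap c b) a = x a := by
    simp [Equiv.swap_apply_of_ne_of_ne hac.ne (hac.trans hcb).ne]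
  refine ⟨hA.1, by simpa [ha] using hxac, ?_⟩
  rw [ha, Equiv.Perm.mul_apply, Equiv.swap_apply_right,
    hasZero_mul_swap_iff hcb hxcb (by simp)]
  exact fun h => hA.2.2 (h.mono le_rfl le_rfl le_rfl hxcb.le)

lemma Admissible.left (hA : Admissible x w a b) (hac : a < c) (hcb : c < b)
    (hxac : x a < x c) (hxcb : x c < x b) : Admissible x w a c :=
  ⟨hac, hxac, fun h => hA.2.2 (h.mono le_rfl hcb.le le_rfl hxcb.le)⟩

lemma Admissible.right (hA : Admissible x w a b) (hac : a < c) (hcb : c < b)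
    (hxac : x a < x c) (hxcb : x c < x b) : Admissible x w c b :=
  ⟨hcb, hxcb, fun h => hA.2.2 (h.mono hac.le le_rfl hxac.le le_rfl)⟩

lemma not_isLost_of_interior (hclean : ∀ i j, Admissible x w i j → IsClean (x * Equiv.swap i j) w)
    (hA : Admissible x w a b) (hac : a < c) (hcb : c < b) (hxac : x a < x c) (hxcb : x c < x b)
    (p : Fin n) : ¬ IsLost x w a b p := by
  have hl := hclean a c (hA.left hac hcb hxac hxcb)
  have hr := hclean c b (hA.right hac hcb hxac hxcb)
  have hl2 := hl _ _ (admissible_right_mul_swap_left hA hac hcb hxac)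
  have hr1 := hr _ _ (admissible_left_mul_swap_right hA hac hcb hxcb)
  have eb : (x * Equiv.swap a c) b = x b := by
    simp [Equiv.swap_apply_of_ne_of_ne (hac.trans hcb).ne' hcb.ne']
  have ea : (x * Equiv.swap c b) a = x a := by
    simp [Equiv.swap_apply_of_ne_of_ne hac.ne (hac.trans hcb).ne]
  rintro (⟨hp, hxp, h1, h2, h3⟩ | ⟨hp, hxp, h1, h2, h3⟩)
  · have hpc := hp.trans hac
    have hpb := hpc.trans hcb
    have el : (x * Equiv.swap a c) p = x p := by
      simp [Equiv.swap_apply_of_ne_of_ne hp.ne hpc.ne]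
    have er : (x * Equiv.swap c b) p = x p := by
      simp [Equiv.swap_apply_of_ne_of_ne hpc.ne hpb.ne]
    have hr1 := hr1.1 p ⟨hp.ne, hpc.ne⟩
    have hl2 := hl2.1 p ⟨hpc.ne, hpb.ne⟩
    simp only [IsLost, ea, eb, el, er, Equiv.Perm.mul_apply, Equiv.swap_apply_left,
      Equiv.swap_apply_right, not_or] at hr1 hl2
    have k1 : ¬ HasZero (x * Equiv.swap c b) w p a (x p) (x a) := by
      rwa [hasZero_mul_swap_iff hcb hxcb (Or.inl hac.le)]
    have k2 : ¬ HasZero x w p c (x p) (x a) := fun h =>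
      hr1.1 ⟨hp, hxp, k1, h2.mul_swap hcb hxcb, h.mul_swap hcb hxcb⟩
    have k3 : ¬ HasZero (x * Equiv.swap a c) w p c (x p) (x a) := by
      rwa [hasZero_mul_swap_iff hac hxac (by simp)]
    exact hl2.1 ⟨hpc, hxp, k3,
      (h2.mono le_rfl hac.le le_rfl le_rfl).mul_swap hac hxac, h3.mul_swap hac hxac⟩
  · have hcp := hcb.trans hp
    have hap := hac.trans hcp
    have el : (x * Equiv.swap a c) p = x p := by
      simp [Equiv.swap_apply_of_ne_of_ne hap.ne' hcp.ne']
    have er : (x * Equiv.swap c b) p = x p := by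
      simp [Equiv.swap_apply_of_ne_of_ne hcp.ne' hp.ne']
    have hl2 := hl2.1 p ⟨hcp.ne', hp.ne'⟩
    have hr1 := hr1.1 p ⟨hap.ne', hcp.ne'⟩
    simp only [IsLost, ea, eb, el, er, Equiv.Perm.mul_apply, Equiv.swap_apply_left,
      Equiv.swap_apply_right, not_or] at hr1 hl2
    have k1 : ¬ HasZero (x * Equiv.swap a c) w b p (x b) (x p) := by
      rwa [hasZero_mul_swap_iff hac hxac (by simp [hcb.le])]
    have k2 : ¬ HasZero x w c p (x b) (x p) := fun h =>
      hl2.2 ⟨hp, hxp, k1, h.mul_swap hac hxac, h3.mul_swap hac hxac⟩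
    have k3 : ¬ HasZero (x * Equiv.swap c b) w c p (x b) (x p) := by
      rwa [hasZero_mul_swap_iff hcb hxcb (by simp)]
    exact hr1.2 ⟨hcp, hxp, k3, h2.mul_swap hcb hxcb,
      (h3.mono hcb.le le_rfl le_rfl le_rfl).mul_swap hcb hxcb⟩

lemma IsClean.two_le {y : Equiv.Perm (Fin n)} (hy : IsClean y w) {i j p q : Fin n}
    (hA : Admissible y w a b) (hI : Admissible y w i j) (hi : i ≠ a ∧ i ≠ b) (hj : j ≠ a ∧ j ≠ b)
    (hp : i ≤ p ∧ p < j ∧ y i < q ∧ q ≤ y j) (hp' : a ≤ p ∧ p < b ∧ y a < q ∧ q ≤ y b) :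
    2 ≤ rankDiff y w p q := by
  by_contra h
  exact (hy a b hA).2 i j hi hj ⟨hI, p, q, hp, hp', by omega⟩

lemma rankDiff_mul_swap_le (hab : a < b) (hx : x a < x b) (p q : Fin n) :
    rankDiff (x * Equiv.swap a b) w p q ≤ rankDiff x w p q := by
  rw [rankDiff_mul_swap x w hab hx]
  split_ifs <;> omega

lemma Admissible.mul_swap {i j : Fin n} (hab : a < b) (hx : x a < x b)
    (hI : Admissible x w i j) (hi : i ≠ a ∧ i ≠ b) (hj : j ≠ a ∧ j ≠ b)
    (h2 : ∀ p q, i ≤ p → p < j → x i < q → q ≤ x j → a ≤ p → p < b → x a < q → q ≤ x b →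
      2 ≤ rankDiff x w p q) : Admissible (x * Equiv.swap a b) w i j := by
  have ei : (x * Equiv.swap a b) i = x i := by simp [Equiv.swap_apply_of_ne_of_ne hi.1 hi.2]
  have ej : (x * Equiv.swap a b) j = x j := by simp [Equiv.swap_apply_of_ne_of_ne hj.1 hj.2]
  refine ⟨hI.1, by simpa [ei, ej] using hI.2.1, ?_⟩
  rw [ei, ej]
  rintro ⟨p, q, c1, c2, c3, c4, hd⟩
  rw [rankDiff_mul_swap x w hab hx] at hd
  split_ifs at hd with hr
  · have := h2 p q c1 c2 c3 c4 hr.1 hr.2.1 hr.2.2.1 hr.2.2.2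
    omega
  · exact hI.2.2 ⟨p, q, c1, c2, c3, c4, by omega⟩

lemma two_le_rankDiff_of_nested
    (hclean : ∀ i j, Admissible x w i j → IsClean (x * Equiv.swap i j) w)
    (hA : Admissible x w a b) (hac : a < c) (hcb : c < b) (hxac : x a < x c) (hxcb : x c < x b)
    {i j p q : Fin n} (hI : Admissible x w i j) (hia : i < a) (hcj : c < j) (hjb : j ≠ b)
    (hxic : x i < x c) (hxcj : x c < x j) (hcp : c ≤ p) (hpb : p < b) (hpj : p < j)
    (hxcq : x c < q) (hqb : q ≤ x b) (hqj : q ≤ x j) : 2 ≤ rankDiff x w p q := by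
  have hb : (x * Equiv.swap a c) b = x b := by
    simp [Equiv.swap_apply_of_ne_of_ne (hac.trans hcb).ne' hcb.ne']
  have hj : (x * Equiv.swap a c) j = x j := by
    simp [Equiv.swap_apply_of_ne_of_ne (hac.trans hcj).ne' hcj.ne']
  have h1 : Admissible (x * Equiv.swap a c) w a j := by
    refine ⟨hac.trans hcj, by simpa [hj] using hxcj, ?_⟩
    rw [hj, Equiv.Perm.mul_apply, Equiv.swap_apply_left, hasZero_mul_swap_iff hac hxac (by simp)]
    exact fun h => hI.2.2 (h.mono hia.le le_rfl hxic.le le_rfl)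
  refine le_trans ?_ (rankDiff_mul_swap_le hac hxac p q)
  refine (hclean a c (hA.left hac hcb hxac hxcb)).two_le
    (admissible_right_mul_swap_left hA hac hcb hxac) h1 ⟨hac.ne, hA.1.ne⟩ ⟨hcj.ne', hjb⟩ ?_ ?_
  · rw [hj, Equiv.Perm.mul_apply, Equiv.swap_apply_left]
    exact ⟨hac.le.trans hcp, hpj, hxcq, hqj⟩
  · rw [hb, Equiv.Perm.mul_apply, Equiv.swap_apply_right]
    exact ⟨hcp, hpb, hxac.trans hxcq, hqb⟩

lemma not_isBlocked_of_ne
    (hclean : ∀ i j, Admissible x w i j → IsClean (x * Equiv.swap i j) w)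
    (hA : Admissible x w a b) (hac : a < c) (hcb : c < b) (hxac : x a < x c) (hxcb : x c < x b)
    {i j : Fin n} (hi : i ≠ a ∧ i ≠ b) (hj : j ≠ a ∧ j ≠ b) (hic : i ≠ c) (hjc : j ≠ c) :
    ¬ IsBlocked x w a b i j := by
  have hl := hclean a c (hA.left hac hcb hxac hxcb)
  have hr := hclean c b (hA.right hac hcb hxac hxcb)
  have eb : (x * Equiv.swap a c) b = x b := by
    simp [Equiv.swap_apply_of_ne_of_ne hA.1.ne' hcb.ne']
  have ea : (x * Equiv.swap c b) a = x a := by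
    simp [Equiv.swap_apply_of_ne_of_ne hac.ne hA.1.ne]
  have eli : (x * Equiv.swap a c) i = x i := by simp [Equiv.swap_apply_of_ne_of_ne hi.1 hic]
  have elj : (x * Equiv.swap a c) j = x j := by simp [Equiv.swap_apply_of_ne_of_ne hj.1 hjc]
  have eri : (x * Equiv.swap c b) i = x i := by simp [Equiv.swap_apply_of_ne_of_ne hic hi.2]
  have erj : (x * Equiv.swap c b) j = x j := by simp [Equiv.swap_apply_of_ne_of_ne hjc hj.2]
  rintro ⟨hI, p, q, ⟨c1, c2, c3, c4⟩, ⟨d1, d2, d3, d4⟩, hd⟩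
  have hL : ∃ p q, i ≤ p ∧ p < j ∧ x i < q ∧ q ≤ x j ∧ a ≤ p ∧ p < c ∧ x a < q ∧ q ≤ x c ∧
      rankDiff x w p q ≤ 1 := by
    by_contra hno
    have hI' : Admissible (x * Equiv.swap a c) w i j :=
      hI.mul_swap hac hxac ⟨hi.1, hic⟩ ⟨hj.1, hjc⟩ fun p q g1 g2 g3 g4 g5 g6 g7 g8 => by
        by_contra hlt
        exact hno ⟨p, q, g1, g2, g3, g4, g5, g6, g7, g8, by omega⟩
    have hle := rankDiff_mul_swap_le (w := w) hac hxac p q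
    rcases le_or_gt c p with hcp | hpc
    · have := hl.two_le (p := p) (q := q) (admissible_right_mul_swap_left hA hac hcb hxac) hI'
        ⟨hic, hi.2⟩ ⟨hjc, hj.2⟩ (by rw [eli, elj]; exact ⟨c1, c2, c3, c4⟩)
        (by rw [eb, Equiv.Perm.mul_apply, Equiv.swap_apply_right]; exact ⟨hcp, d2, d3, d4⟩)
      omega
    · have hq : x c < q := by
        by_contra hq
        exact hno ⟨p, q, c1, c2, c3, c4, d1, hpc, d3, not_lt.1 hq, hd⟩
      have := hl.two_le (p := p) (q := q)
        (admissible_left_mul_swap_left hA hac hcb hxac hxcb) hI'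
        hi hj (by rw [eli, elj]; exact ⟨c1, c2, c3, c4⟩)
        (by rw [eb, Equiv.Perm.mul_apply, Equiv.swap_apply_left]; exact ⟨d1, d2, hq, d4⟩)
      omega
  have hR : ∃ p q, i ≤ p ∧ p < j ∧ x i < q ∧ q ≤ x j ∧ c ≤ p ∧ p < b ∧ x c < q ∧ q ≤ x b ∧
      rankDiff x w p q ≤ 1 := by
    by_contra hno
    have hI' : Admissible (x * Equiv.swap c b) w i j :=
      hI.mul_swap hcb hxcb ⟨hic, hi.2⟩ ⟨hjc, hj.2⟩ fun p q g1 g2 g3 g4 g5 g6 g7 g8 => by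
        by_contra hlt
        exact hno ⟨p, q, g1, g2, g3, g4, g5, g6, g7, g8, by omega⟩
    have hle := rankDiff_mul_swap_le (w := w) hcb hxcb p q
    rcases lt_or_ge p c with hpc | hcp
    · have := hr.two_le (p := p) (q := q) (admissible_left_mul_swap_right hA hac hcb hxcb) hI'
        ⟨hi.1, hic⟩ ⟨hj.1, hjc⟩ (by rw [eri, erj]; exact ⟨c1, c2, c3, c4⟩)
        (by rw [ea, Equiv.Perm.mul_apply, Equiv.swap_apply_left]; exact ⟨d1, hpc, d3, d4⟩)
      omega
    · have hq : q ≤ x c := by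
        by_contra hq
        exact hno ⟨p, q, c1, c2, c3, c4, hcp, d2, not_le.1 hq, d4, hd⟩
      have := hr.two_le (p := p) (q := q)
        (admissible_right_mul_swap_right hA hac hcb hxac hxcb) hI'
        hi hj (by rw [eri, erj]; exact ⟨c1, c2, c3, c4⟩)
        (by rw [ea, Equiv.Perm.mul_apply, Equiv.swap_apply_right]; exact ⟨d1, d2, d3, hq⟩)
      omega
  obtain ⟨p₁, q₁, f1, -, f3, -, -, f6, -, f8, -⟩ := hL
  obtain ⟨p₂, q₂, -, g2, -, g4, g5, g6, g7, g8, g9⟩ := hR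
  have hic' := f1.trans_lt f6
  have hcj' := g5.trans_lt g2
  have hxic := f3.trans_le f8
  have hxcj := g7.trans_le g4
  rcases lt_or_gt_of_ne hi.1 with h | h
  · have := two_le_rankDiff_of_nested hclean hA hac hcb hxac hxcb hI h hcj' hj.2 hxic hxcj
      g5 g6 g2 g7 g8 g4
    omega
  · have := two_le_rankDiff_of_nested hclean hI hic' hcj' hxic hxcj hA h hcb hj.2.symm hxac hxcb
      g5 g2 g6 g7 g4 g8
    omega

lemma not_isBlocked_left
    (hclean : ∀ i j, Admissible x w i j → IsClean (x * Equiv.swap i j) w)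
    (hA : Admissible x w a b) (hac : a < c) (hcb : c < b) (hxac : x a < x c) (hxcb : x c < x b)
    {i : Fin n} (hia : i ≠ a) (hib : i ≠ b) : ¬ IsBlocked x w a b i c := by
  have hr := hclean c b (hA.right hac hcb hxac hxcb)
  have ea : (x * Equiv.swap c b) a = x a := by
    simp [Equiv.swap_apply_of_ne_of_ne hac.ne hA.1.ne]
  rintro ⟨hI, p, q, ⟨c1, c2, c3, c4⟩, ⟨d1, d2, d3, d4⟩, hd⟩
  have ei : (x * Equiv.swap c b) i = x i := by simp [Equiv.swap_apply_of_ne_of_ne hI.1.ne hib]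
  have hle := rankDiff_mul_swap_le (w := w) hcb hxcb p q
  have h1 : HasZero x w i c (x i) (x b) := by
    by_contra hno
    have hI' : Admissible (x * Equiv.swap c b) w i c := by
      refine ⟨hI.1, by simpa [ei] using hI.2.1.trans hxcb, ?_⟩
      rwa [ei, Equiv.Perm.mul_apply, Equiv.swap_apply_left,
        hasZero_mul_swap_iff hcb hxcb (by simp)]
    have := hr.two_le (p := p) (q := q) (admissible_right_mul_swap_right hA hac hcb hxac hxcb) hI'
      ⟨hia, hib⟩ ⟨hac.ne', hcb.ne⟩
      (by rw [ei, Equiv.Perm.mul_apply, Equiv.swap_apply_left]; exact ⟨c1, c2, c3, d4⟩)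
      (by rw [ea, Equiv.Perm.mul_apply, Equiv.swap_apply_right]; exact ⟨d1, d2, d3, c4⟩)
    omega
  have h2 : HasZero x w i b (x i) (x c) := by
    by_contra hno
    have hI' : Admissible (x * Equiv.swap c b) w i b := by
      refine ⟨hI.1.trans hcb, by simpa [ei] using hI.2.1, ?_⟩
      rwa [ei, Equiv.Perm.mul_apply, Equiv.swap_apply_right,
        hasZero_mul_swap_iff hcb hxcb (by simp)]
    have := hr.two_le (p := p) (q := q) (admissible_left_mul_swap_right hA hac hcb hxcb) hI'
      ⟨hia, hI.1.ne⟩ ⟨hA.1.ne', hcb.ne'⟩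
      (by rw [ei, Equiv.Perm.mul_apply, Equiv.swap_apply_right]; exact ⟨c1, d2, c3, c4⟩)
      (by rw [ea, Equiv.Perm.mul_apply, Equiv.swap_apply_left]; exact ⟨d1, c2, d3, d4⟩)
    omega
  have h3 := (h1.split_right (x c)).resolve_left hI.2.2
  have h4 := (h2.split_left c).resolve_left hI.2.2
  have hia' : i < a := by
    by_contra h
    exact hA.2.2 (h3.mono (not_lt.1 h) hcb.le hxac.le le_rfl)
  have hxia : x i < x a := by
    by_contra h
    exact hA.2.2 (h4.mono hac.le le_rfl (not_lt.1 h) hxcb.le)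
  refine not_isLost_of_interior hclean hA hac hcb hxac hxcb i (Or.inl ⟨hia', hxia, ?_, ?_, ?_⟩)
  · exact fun h => hI.2.2 (h.mono le_rfl hac.le le_rfl hxac.le)
  · exact ((h3.split_left a).resolve_right fun h =>
      hA.2.2 (h.mono le_rfl hcb.le hxac.le le_rfl)).mono le_rfl le_rfl hI.2.1.le le_rfl
  · exact ((h4.split_right (x a)).resolve_right fun h =>
      hA.2.2 (h.mono hac.le le_rfl le_rfl hxcb.le)).mono hI.1.le le_rfl le_rfl le_rfl

lemma not_isBlocked_right
    (hclean : ∀ i j, Admissible x w i j → IsClean (x * Equiv.swap i j) w)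
    (hA : Admissible x w a b) (hac : a < c) (hcb : c < b) (hxac : x a < x c) (hxcb : x c < x b)
    {j : Fin n} (hja : j ≠ a) (hjb : j ≠ b) : ¬ IsBlocked x w a b c j := by
  have hl := hclean a c (hA.left hac hcb hxac hxcb)
  have eb : (x * Equiv.swap a c) b = x b := by
    simp [Equiv.swap_apply_of_ne_of_ne hA.1.ne' hcb.ne']
  rintro ⟨hI, p, q, ⟨c1, c2, c3, c4⟩, ⟨d1, d2, d3, d4⟩, hd⟩
  have ej : (x * Equiv.swap a c) j = x j := by simp [Equiv.swap_apply_of_ne_of_ne hja hI.1.ne']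
  have hle := rankDiff_mul_swap_le (w := w) hac hxac p q
  have h1 : HasZero x w c j (x a) (x j) := by
    by_contra hno
    have hI' : Admissible (x * Equiv.swap a c) w c j := by
      refine ⟨hI.1, by simpa [ej] using hxac.trans hI.2.1, ?_⟩
      rwa [ej, Equiv.Perm.mul_apply, Equiv.swap_apply_right,
        hasZero_mul_swap_iff hac hxac (by simp)]
    have := hl.two_le (p := p) (q := q) (admissible_left_mul_swap_left hA hac hcb hxac hxcb) hI'
      ⟨hac.ne', hcb.ne⟩ ⟨hja, hjb⟩
      (by rw [ej, Equiv.Perm.mul_apply, Equiv.swap_apply_right]; exact ⟨c1, c2, d3, c4⟩)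
      (by rw [eb, Equiv.Perm.mul_apply, Equiv.swap_apply_left]; exact ⟨d1, d2, c3, d4⟩)
    omega
  have h2 : HasZero x w a j (x c) (x j) := by
    by_contra hno
    have hI' : Admissible (x * Equiv.swap a c) w a j := by
      refine ⟨hac.trans hI.1, by simpa [ej] using hI.2.1, ?_⟩
      rwa [ej, Equiv.Perm.mul_apply, Equiv.swap_apply_left,
        hasZero_mul_swap_iff hac hxac (by simp)]
    have := hl.two_le (p := p) (q := q) (admissible_right_mul_swap_left hA hac hcb hxac) hI'
      ⟨hac.ne, hA.1.ne⟩ ⟨hI.1.ne', hjb⟩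
      (by rw [ej, Equiv.Perm.mul_apply, Equiv.swap_apply_left]; exact ⟨d1, c2, c3, c4⟩)
      (by rw [eb, Equiv.Perm.mul_apply, Equiv.swap_apply_right]; exact ⟨c1, d2, d3, d4⟩)
    omega
  have h3 := (h1.split_right (x c)).resolve_right hI.2.2
  have h4 := (h2.split_left c).resolve_right hI.2.2
  have hbj : b < j := by
    by_contra h
    exact hA.2.2 (h3.mono hac.le (not_lt.1 h) le_rfl hxcb.le)
  have hxbj : x b < x j := by
    by_contra h
    exact hA.2.2 (h4.mono le_rfl hcb.le hxac.le (not_lt.1 h))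
  refine not_isLost_of_interior hclean hA hac hcb hxac hxcb j (Or.inr ⟨hbj, hxbj, ?_, ?_, ?_⟩)
  · exact fun h => hI.2.2 (h.mono hcb.le le_rfl hxcb.le le_rfl)
  · exact ((h4.split_right (x b)).resolve_left fun h =>
      hA.2.2 (h.mono le_rfl hcb.le hxac.le le_rfl)).mono le_rfl hI.1.le le_rfl le_rfl
  · exact ((h3.split_left b).resolve_left fun h =>
      hA.2.2 (h.mono hac.le le_rfl le_rfl hxcb.le)).mono le_rfl le_rfl le_rfl hI.2.1.le

end Interior

lemma numObstructed_mul_swap_eq_of_interior {n : ℕ} {x w : Equiv.Perm (Fin n)} {a b c : Fin n}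
    (hclean : ∀ i j, Admissible x w i j → IsClean (x * Equiv.swap i j) w)
    (hA : Admissible x w a b) (hac : a < c) (hcb : c < b) (hxac : x a < x c) (hxcb : x c < x b) :
    numObstructed x w = numObstructed (x * Equiv.swap a b) w := by
  refine (numObstructed_le_and_eq_iff hA).2.2
    ⟨fun p _ => not_isLost_of_interior hclean hA hac hcb hxac hxcb p, fun i j hi hj => ?_⟩
  by_cases hic : i = c
  · subst hic
    exact not_isBlocked_right hclean hA hac hcb hxac hxcb hj.1 hj.2
  by_cases hjc : j = c
  · subst hjc
    exact not_isBlocked_left hclean hA hac hcb hxac hxcb hi.1 hi.2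
  exact not_isBlocked_of_ne hclean hA hac hcb hxac hxcb hi hj hic hjc

/-- If `x ∈ S_n` is a maximal singular point for `w ∈ S_n` and `t ∈ R(x,w)`,
then `l(xt) = l(x) + 1`. -/
theorem msp_length_add_one {n : ℕ} (x w : Equiv.Perm (Fin n)) (hmsp : MSP x w)
    (t : Equiv.Perm (Fin n)) (ht : t ∈ R x w) :
    invLen (x * t) = invLen x + 1 := by
  obtain ⟨hxw, hsing, hsmooth⟩ := hmsp
  have hw : bruhatLE w w := fun p q => by simp [dxw]
  have hcw := ncard_R_add_numObstructed hw
  rw [ncard_R_self] at hcw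
  have hlt : numObstructed x w < numObstructed w w := by
    have := ncard_R_add_numObstructed hxw
    push_cast at hcw
    linarith
  have heq : ∀ i j, Admissible x w i j →
      numObstructed (x * Equiv.swap i j) w = numObstructed w w := by
    intro i j hI
    have h1 := ncard_R_add_numObstructed (hI.bruhatLE_mul_swap hxw)
    have h2 := hsmooth _ ((swap_mem_R_iff hxw hI.1).2 hI)
    push_cast at hcw
    linarith
  have hclean : ∀ i j, Admissible x w i j → IsClean (x * Equiv.swap i j) w := fun i j hI =>
    isClean_of_numObstructed_eq (hI.bruhatLE_mul_swap hxw) (heq i j hI)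
  obtain ⟨a, b, hA, rfl⟩ := (mem_R_iff hxw).1 ht
  refine invLen_mul_swap_of_forall x hA.1 hA.2.1 fun c hac hcb hxac hxcb => hlt.ne ?_
  rw [numObstructed_mul_swap_eq_of_interior hclean hA hac hcb hxac hxcb, heq a b hA]

end BSW
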